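/- arXiv:2504.06556 — 3 statements merged into one kernel-verified Lean document; each statement's English description precedes it below -/
import Mathlib

section
/- For integers n, d with 1 ≤ d ≤ n−2 and every integer i with 1 ≤ i ≤ n−d−2, one has A(n,d;i) ≥ A(n,d;i−1)·(n−i)/C(n,2), where C(n,2) = n(n−1)/2. -/
/-- The tree-distance between two spanning trees on `Fin n`:
`d(T₁,T₂) = n - 1 - |E₁ ∩ E₂|`. -/
noncomputable def treeDist {n : ℕ} (G H : SimpleGraph (Fin n)) : ℕ :=
  n - 1 - (G.edgeSet ∩ H.edgeSet).ncard

/-- An `(n,d)` tree-code: a finite set of (spanning) trees on `Fin n`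
such that any two distinct members have tree-distance at least `d`. -/
def IsTreeCode (n d : ℕ) (C : Finset (SimpleGraph (Fin n))) : Prop :=
  (∀ G ∈ C, G.IsTree) ∧ ∀ G ∈ C, ∀ H ∈ C, G ≠ H → d ≤ treeDist G H

/-- `A n d`: the maximum size of an `(n,d)` tree-code. -/
noncomputable def A (n d : ℕ) : ℕ :=
  sSup {m : ℕ | ∃ C : Finset (SimpleGraph (Fin n)), IsTreeCode n d C ∧ C.card = m}

/-- An `(n,d;i)` tree-code: an `(n,d)` tree-code all of whose trees contain
a common set of at least `i` edges. -/
def IsTreeCodeCommon (n d i : ℕ) (C : Finset (SimpleGraph (Fin n))) : Prop :=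
  IsTreeCode n d C ∧
    ∃ E : Finset (Sym2 (Fin n)), i ≤ E.card ∧ ∀ G ∈ C, (E : Set (Sym2 (Fin n))) ⊆ G.edgeSet

/-- `Acommon n d i`: the maximum size of an `(n,d;i)` tree-code. -/
noncomputable def Acommon (n d i : ℕ) : ℕ :=
  sSup {m : ℕ | ∃ C : Finset (SimpleGraph (Fin n)), IsTreeCodeCommon n d i C ∧ C.card = m}

/-- The sizes of `(n,d;i)` tree-codes are bounded above. -/
theorem bddAbove_treeCodeCommon_card (n d i : ℕ) :
    BddAbove {m : ℕ | ∃ C : Finset (SimpleGraph (Fin n)),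
      IsTreeCodeCommon n d i C ∧ C.card = m} := by
  classical
  refine ⟨Fintype.card (SimpleGraph (Fin n)), ?_⟩
  rintro m ⟨C, -, rfl⟩
  exact C.card_le_univ

theorem IsTreeCodeCommon.card_le_Acommon {n d i : ℕ} {C : Finset (SimpleGraph (Fin n))}
    (hC : IsTreeCodeCommon n d i C) : C.card ≤ Acommon n d i :=
  le_csSup (bddAbove_treeCodeCommon_card n d i) ⟨C, hC, rfl⟩

/-- The maximum defining `Acommon` is attained whenever the empty code is admissible. -/
theorem exists_isTreeCodeCommon_card_eq {n d i : ℕ} (hi : i ≤ n.choose 2) :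
    ∃ C : Finset (SimpleGraph (Fin n)),
      IsTreeCodeCommon n d i C ∧ C.card = Acommon n d i := by
  classical
  refine Nat.sSup_mem (s := {m : ℕ | ∃ C : Finset (SimpleGraph (Fin n)),
    IsTreeCodeCommon n d i C ∧ C.card = m}) ⟨0, ∅, ⟨by simp [IsTreeCode], ?_⟩, rfl⟩
    (bddAbove_treeCodeCommon_card n d i)
  refine ⟨(⊤ : SimpleGraph (Fin n)).edgeFinset, ?_, by simp⟩
  rw [SimpleGraph.card_edgeFinset_top_eq_card_choose_two]
  simpa using hi

/-- Double counting pairs of a tree of the code and an edge of it outside the common edges. -/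
theorem IsTreeCodeCommon.card_mul_le {n d i : ℕ} {C : Finset (SimpleGraph (Fin n))}
    (hC : IsTreeCodeCommon n d i C) :
    C.card * (n - 1 - i) ≤ n.choose 2 * Acommon n d (i + 1) := by
  classical
  obtain ⟨⟨htree, hdist⟩, E', hE'card, hE'⟩ := hC
  obtain ⟨E, hEE', rfl⟩ := Finset.exists_subset_card_eq hE'card
  have hE : ∀ G ∈ C, (E : Set (Sym2 (Fin n))) ⊆ G.edgeSet := fun G hG =>
    (Finset.coe_subset.2 hEE').trans (hE' G hG)
  have hcard := SimpleGraph.card_edgeFinset_top_eq_card_choose_two (V := Fin n)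
  rw [Fintype.card_fin] at hcard
  rw [← hcard]
  refine Finset.card_mul_le_card_mul (fun G e => e ∈ G.edgeSet ∧ e ∉ E) ?_ ?_
  · intro G hG
    have hsub : G.edgeFinset \ E ⊆
        Finset.bipartiteAbove (fun G e => e ∈ G.edgeSet ∧ e ∉ E)
          (⊤ : SimpleGraph (Fin n)).edgeFinset G := by
      intro e he
      rw [Finset.mem_sdiff, SimpleGraph.mem_edgeFinset] at he
      rw [Finset.mem_bipartiteAbove, SimpleGraph.mem_edgeFinset]
      exact ⟨SimpleGraph.edgeSet_mono le_top he.1, he⟩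
    refine le_trans ?_ (Finset.card_le_card hsub)
    have hG' := (htree G hG).card_edgeFinset
    rw [Fintype.card_fin] at hG'
    have := Finset.le_card_sdiff E G.edgeFinset
    omega
  · intro e _
    by_cases heE : e ∈ E
    · simp [Finset.bipartiteBelow, heE]
    · refine IsTreeCodeCommon.card_le_Acommon ⟨⟨?_, ?_⟩, insert e E, ?_, ?_⟩
      · exact fun G hG => htree G (Finset.mem_of_mem_filter G hG)
      · exact fun G hG H hH => hdist G (Finset.mem_of_mem_filter G hG)
          H (Finset.mem_of_mem_filter H hH)
      · rw [Finset.card_insert_of_notMem heE]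
      · intro G hG
        rw [Finset.mem_bipartiteBelow] at hG
        rw [Finset.coe_insert]
        exact Set.insert_subset hG.2.1 (hE G hG.1)

theorem stmt1 (n d i : ℕ) (hd1 : 1 ≤ d) (hd2 : d ≤ n - 2)
    (hi1 : 1 ≤ i) (hi2 : i ≤ n - d - 2) :
    (Acommon n d (i - 1) : ℝ) * ((n : ℝ) - i) / (n.choose 2 : ℝ) ≤ (Acommon n d i : ℝ) := by
  have hin : i ≤ n := by omega
  have hchoose : n - 1 ≤ n.choose 2 := by
    obtain ⟨m, rfl⟩ : ∃ m, n = m + 1 := ⟨n - 1, by omega⟩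
    rw [Nat.choose_succ_succ' m 1, Nat.choose_one_right]
    omega
  obtain ⟨C, hC, hcard⟩ := exists_isTreeCodeCommon_card_eq (n := n) (d := d) (i := i - 1)
    (by omega)
  have key := hC.card_mul_le
  rw [hcard, Nat.sub_add_cancel hi1, show n - 1 - (i - 1) = n - i by omega] at key
  have hpos : (0 : ℝ) < (n.choose 2 : ℝ) := by
    exact_mod_cast (show 0 < n.choose 2 by omega)
  rw [div_le_iff₀ hpos, ← Nat.cast_sub hin, mul_comm (Acommon n d i : ℝ)]
  exact_mod_cast key
end

section
/- Let δ ∈ (0.1313, 1) and set C_δ = (e/2)·δ^(δ/(1−δ)). Then there exists N such that for all n ≥ N and every integer d with d = δn, one has A(n,d) ≤ 1.2·(C_δ·n)^(n−d). -/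
open Finset in
/-- In a tree-code of distance `d`, every set of `n - d` edges lies in at most one tree. -/
theorem IsTreeCode.card_mul_choose_le {n d : ℕ} {C : Finset (SimpleGraph (Fin n))}
    (hC : IsTreeCode n d C) (hd : 0 < d) (hdn : d ≤ n) :
    C.card * (n - 1).choose (n - d) ≤ (n.choose 2).choose (n - d) := by
  classical
  have hcard : ∀ G ∈ C, (powersetCard (n - d) G.edgeFinset).card = (n - 1).choose (n - d) := by
    intro G hG
    have h := (hC.1 G hG).card_edgeFinset
    rw [Fintype.card_fin] at h
    rw [card_powersetCard, Nat.eq_sub_of_add_eq h]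
  have hdisj : (C : Set (SimpleGraph (Fin n))).PairwiseDisjoint
      fun G => powersetCard (n - d) G.edgeFinset := by
    intro G hG H hH hne
    refine Finset.disjoint_left.2 fun S hSG hSH => ?_
    rw [mem_powersetCard] at hSG hSH
    have hdist : d ≤ n - 1 - (G.edgeSet ∩ H.edgeSet).ncard := hC.2 G hG H hH hne
    have hsub : (S : Set (Sym2 (Fin n))) ⊆ G.edgeSet ∩ H.edgeSet := fun x hx =>
      ⟨SimpleGraph.mem_edgeFinset.1 (hSG.1 hx), SimpleGraph.mem_edgeFinset.1 (hSH.1 hx)⟩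
    have hle := Set.ncard_le_ncard hsub (Set.toFinite _)
    rw [Set.ncard_coe_finset, hSG.2] at hle
    omega
  calc C.card * (n - 1).choose (n - d)
      = (C.biUnion fun G => powersetCard (n - d) G.edgeFinset).card := by
        rw [card_biUnion hdisj, sum_congr rfl hcard, sum_const, smul_eq_mul]
    _ ≤ (powersetCard (n - d) (⊤ : SimpleGraph (Fin n)).edgeFinset).card := by
        refine card_le_card (biUnion_subset.2 fun G _ => powersetCard_mono ?_)
        exact SimpleGraph.edgeFinset_mono le_top
    _ = (n.choose 2).choose (n - d) := by
        rw [card_powersetCard, SimpleGraph.card_edgeFinset_top_eq_card_choose_two,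
          Fintype.card_fin]

theorem exists_isTreeCode_card_eq_A (n d : ℕ) :
    ∃ C : Finset (SimpleGraph (Fin n)), IsTreeCode n d C ∧ C.card = A n d := by
  classical
  refine Nat.sSup_mem
    (s := {m : ℕ | ∃ C : Finset (SimpleGraph (Fin n)), IsTreeCode n d C ∧ C.card = m}) ?_ ?_
  · exact ⟨0, ∅, by simp [IsTreeCode], rfl⟩
  · refine ⟨Fintype.card (SimpleGraph (Fin n)), ?_⟩
    rintro m ⟨C, -, rfl⟩
    exact Finset.card_le_univ C

open Nat in
theorem A_mul_factorial_le {n d : ℕ} (hd : 0 < d) (hdn : d ≤ n) :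
    (A n d : ℝ) * (d * n !) ≤ (n * (n - 1) / 2 : ℝ) ^ (n - d) * (n * d !) := by
  obtain ⟨C, hC, hcard⟩ := exists_isTreeCode_card_eq_A n d
  have hle : (A n d : ℝ) * (n - 1).choose (n - d) ≤ (n.choose 2).choose (n - d) := by
    rw [← hcard]
    exact_mod_cast hC.card_mul_choose_le hd hdn
  have hpow := hle.trans (Nat.choose_le_pow_div (α := ℝ) (n - d) (n.choose 2))
  rw [Nat.cast_choose_two, le_div_iff₀ (by positivity)] at hpow
  have hfac : ((n - 1).choose (n - d) * (n - d)! : ℝ) * (d - 1)! = (n - 1)! := by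
    have h := Nat.choose_mul_factorial_mul_factorial (n := n - 1) (k := n - d) (by omega)
    rw [show n - 1 - (n - d) = d - 1 by omega] at h
    exact_mod_cast h
  have hdf : (d ! : ℝ) = d * (d - 1)! := by exact_mod_cast (Nat.mul_factorial_pred hd.ne').symm
  have hnf : (n ! : ℝ) = n * (n - 1)! := by
    exact_mod_cast (Nat.mul_factorial_pred (by omega)).symm
  calc (A n d : ℝ) * (d * n !)
      = (A n d * (n - 1).choose (n - d) * (n - d)!) * (n * (d * (d - 1)!)) := by
        rw [hnf, ← hfac]; ring
    _ ≤ (n * (n - 1) / 2 : ℝ) ^ (n - d) * (n * d !) := by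
        rw [hdf]; gcongr

open Nat in
theorem factorial_eq_stirlingSeq_mul {n : ℕ} (hn : 0 < n) :
    (n ! : ℝ) = Stirling.stirlingSeq n * (√(2 * n) * (n / Real.exp 1) ^ n) := by
  have : (0 : ℝ) < n := by exact_mod_cast hn
  rw [Stirling.stirlingSeq, div_mul_cancel₀]
  positivity

open Nat in
theorem exists_factorial_le_of_eq_mul {δ c : ℝ} (hδ : 0 < δ) (hδ1 : δ < 1) (hc : 1 < c) :
    ∃ N : ℕ, ∀ n : ℕ, N ≤ n → ∀ d : ℕ, (d : ℝ) = δ * n →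
      (d ! : ℝ) ≤ c * √δ * δ ^ d * (Real.exp 1 / n) ^ (n - d) * n ! := by
  have hpi : (0 : ℝ) < √Real.pi := by positivity
  have hev := Stirling.tendsto_stirlingSeq_sqrt_pi.eventually
    (ge_mem_nhds (show √Real.pi < c * √Real.pi by nlinarith))
  obtain ⟨M, hM⟩ := Filter.eventually_atTop.1 hev
  refine ⟨⌈(M + 1 : ℝ) / δ⌉₊, fun n hn d hd => ?_⟩
  have hMd : (M + 1 : ℝ) ≤ d := by
    rw [hd, mul_comm, ← div_le_iff₀ hδ]
    exact Nat.ceil_le.1 hn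
  have hMd' : M + 1 ≤ d := by exact_mod_cast hMd
  have hd0 : 0 < d := by omega
  have hn0 : (0 : ℝ) < n := by
    by_contra h
    have : (0 : ℝ) < d := by exact_mod_cast hd0
    nlinarith
  have hn0' : 0 < n := by exact_mod_cast hn0
  have hdn : d ≤ n := by
    have : (d : ℝ) ≤ n := by nlinarith
    exact_mod_cast this
  have hs : Stirling.stirlingSeq d ≤ c * Stirling.stirlingSeq n :=
    (hM d (by omega)).trans
      (mul_le_mul_of_nonneg_left (Stirling.sqrt_pi_le_stirlingSeq hn0'.ne') (by linarith))
  have hpow : ((d : ℝ) / Real.exp 1) ^ d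
      = δ ^ d * (Real.exp 1 / n) ^ (n - d) * (n / Real.exp 1) ^ n := by
    conv_rhs => rw [← Nat.sub_add_cancel hdn, pow_add, Nat.sub_add_cancel hdn]
    rw [hd, mul_div_assoc, mul_pow]
    have : (Real.exp 1 / n : ℝ) ^ (n - d) * (n / Real.exp 1) ^ (n - d) = 1 := by
      rw [← mul_pow, div_mul_div_cancel₀ hn0.ne', div_self (Real.exp_pos 1).ne', one_pow]
    linear_combination -(δ ^ d * (n / Real.exp 1) ^ d) * this
  have hsqrt : √(2 * d : ℝ) = √δ * √(2 * n) := by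
    rw [hd, ← Real.sqrt_mul hδ.le]; ring_nf
  rw [factorial_eq_stirlingSeq_mul hd0, factorial_eq_stirlingSeq_mul hn0', hpow, hsqrt]
  calc Stirling.stirlingSeq d * (√δ * √(2 * n) *
          (δ ^ d * (Real.exp 1 / n) ^ (n - d) * (n / Real.exp 1) ^ n))
      ≤ (c * Stirling.stirlingSeq n) * (√δ * √(2 * n) *
          (δ ^ d * (Real.exp 1 / n) ^ (n - d) * (n / Real.exp 1) ^ n)) := by gcongr
    _ = _ := by ring

theorem le_mul_exp_two_mul_one_sub {δ : ℝ} (h0 : 0.1313 < δ) (h1 : δ < 1) :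
    0.72 ≤ δ * Real.exp (2 * (1 - δ)) := by
  obtain ⟨u, rfl⟩ : ∃ u, δ = 1 - u := ⟨1 - δ, by ring⟩
  have hu0 : 0 ≤ u := by linarith
  have hu1 : u ≤ 0.8687 := by linarith
  have hexp := Real.sum_le_exp_of_nonneg (x := 2 * u) (by linarith) 5
  simp only [Finset.sum_range_succ, Finset.sum_range_zero, Nat.factorial] at hexp
  push_cast at hexp
  have hu3 : u ^ 3 ≤ 0.8687 ^ 2 * u := by
    have := mul_le_mul_of_nonneg_right (pow_le_pow_left₀ hu0 hu1 2) hu0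
    linarith [pow_succ u 2]
  have hu4 : u ^ 4 ≤ 0.8687 ^ 3 * u := by
    have := mul_le_mul_of_nonneg_right (pow_le_pow_left₀ hu0 hu1 3) hu0
    linarith [pow_succ u 3]
  have hu5 : u ^ 5 ≤ 0.8687 ^ 4 * u := by
    have := mul_le_mul_of_nonneg_right (pow_le_pow_left₀ hu0 hu1 4) hu0
    linarith [pow_succ u 4]
  have hmul := mul_le_mul_of_nonneg_left hexp (show 0 ≤ 1 - u by linarith)
  rw [sub_sub_cancel]
  refine le_trans ?_ hmul
  ring_nf
  norm_num at hu3 hu4 hu5 ⊢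
  linarith

theorem exp_neg_one_sub_le_mul_sqrt {δ : ℝ} (h0 : 0.1313 < δ) (h1 : δ < 1) :
    1.01 * Real.exp (-(1 - δ)) ≤ 1.2 * √δ := by
  have hδ : 0 < δ := by linarith
  have h := le_mul_exp_two_mul_one_sub h0 h1
  have hsq : Real.exp (2 * (1 - δ)) = Real.exp (1 - δ) ^ 2 := by
    rw [← Real.exp_nat_mul]; norm_num
  have hprod : (1.01 : ℝ) ≤ 1.2 * (√δ * Real.exp (1 - δ)) := by
    refine (sq_le_sq₀ (by norm_num) (by positivity)).1 ?_
    rw [mul_pow, mul_pow, Real.sq_sqrt hδ.le, ← hsq]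
    linarith
  rw [Real.exp_neg, ← div_eq_mul_inv, div_le_iff₀ (Real.exp_pos _)]
  linarith

theorem stmt5 (δ : ℝ) (hδ1 : 0.1313 < δ) (hδ2 : δ < 1) :
    ∃ N : ℕ, ∀ n : ℕ, N ≤ n → ∀ d : ℕ, (d : ℝ) = δ * n →
      (A n d : ℝ) ≤ 1.2 * ((Real.exp 1 / 2 * δ ^ (δ / (1 - δ))) * n) ^ (n - d) := by
  have hδ : 0 < δ := by linarith
  obtain ⟨N, hN⟩ := exists_factorial_le_of_eq_mul hδ hδ2 (c := 1.01) (by norm_num)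
  refine ⟨N + 1, fun n hn d hd => ?_⟩
  have hn0' : 0 < n := by omega
  have hn1 : (1 : ℝ) ≤ n := by exact_mod_cast hn0'
  have hn0 : (0 : ℝ) < n := by linarith
  have hd0 : (0 : ℝ) < d := by rw [hd]; positivity
  have hd0' : 0 < d := by exact_mod_cast hd0
  have hdn : d ≤ n := by
    have : (d : ℝ) ≤ n := by nlinarith
    exact_mod_cast this
  have hm : ((n - d : ℕ) : ℝ) = (1 - δ) * n := by rw [Nat.cast_sub hdn, hd]; ring
  have hrpow : (δ ^ (δ / (1 - δ))) ^ (n - d) = δ ^ d := by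
    rw [← Real.rpow_natCast, ← Real.rpow_mul hδ.le, hm, ← Real.rpow_natCast δ d, hd]
    congr 1
    have : 1 - δ ≠ 0 := by linarith
    field_simp
  have hbase : (n * (n - 1) / 2 : ℝ) ^ (n - d)
      ≤ (n * n / 2 : ℝ) ^ (n - d) * Real.exp (-(1 - δ)) := by
    have hexp : Real.exp (-(1 - δ)) = Real.exp (-(1 / n)) ^ (n - d) := by
      rw [← Real.exp_nat_mul, hm]
      congr 1
      field_simp
    rw [hexp, ← mul_pow]
    have h := Real.add_one_le_exp (-(1 / n : ℝ))
    refine pow_le_pow_left₀ (div_nonneg (mul_nonneg hn0.le (by linarith)) (by norm_num)) ?_ _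
    calc (n * (n - 1) / 2 : ℝ) = n * n / 2 * (-(1 / n) + 1) := by field_simp; ring
      _ ≤ _ := by gcongr
  have hfac : (0 : ℝ) < d * n.factorial := by positivity
  refine le_of_mul_le_mul_right ?_ hfac
  calc (A n d : ℝ) * (d * n.factorial)
      ≤ (n * (n - 1) / 2 : ℝ) ^ (n - d) * (n * d.factorial) := A_mul_factorial_le hd0' hdn
    _ ≤ ((n * n / 2 : ℝ) ^ (n - d) * Real.exp (-(1 - δ))) *
          (n * (1.01 * √δ * δ ^ d * (Real.exp 1 / n) ^ (n - d) * n.factorial)) := by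
        gcongr
        exact hN n (by omega) d hd
    _ = (1.01 * Real.exp (-(1 - δ))) * (√δ * δ ^ d *
          ((n * n / 2) * (Real.exp 1 / n)) ^ (n - d) * (n * n.factorial)) := by
        rw [mul_pow]; ring
    _ ≤ (1.2 * √δ) * (√δ * δ ^ d *
          ((n * n / 2) * (Real.exp 1 / n)) ^ (n - d) * (n * n.factorial)) := by
        exact mul_le_mul_of_nonneg_right (exp_neg_one_sub_le_mul_sqrt hδ1 hδ2) (by positivity)
    _ = 1.2 * ((Real.exp 1 / 2 * δ ^ (δ / (1 - δ))) * n) ^ (n - d) * (d * n.factorial) := by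
        rw [show (Real.exp 1 / 2 * δ ^ (δ / (1 - δ))) * n
            = δ ^ (δ / (1 - δ)) * ((n * n / 2) * (Real.exp 1 / n)) by field_simp,
          mul_pow (δ ^ (δ / (1 - δ))), hrpow, hd]
        linear_combination (1.2 * δ ^ d * ((n * n / 2) * (Real.exp 1 / n)) ^ (n - d) *
          (n * n.factorial)) * Real.mul_self_sqrt hδ.le
end

section
/- For all integers n ≥ 35, A(n, n−4; 2) ≤ n + 4. -/
/-- Double counting: finite sets of size `k` inside `U` that pairwise meet in at most one element
satisfy a bound coming from `(r - 2) * (r - 3) ≥ 0`, where `r` is the multiplicity of a point. -/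
theorem four_mul_card_mul_le_of_card_inter_le_one {α β : Type*} [DecidableEq α] [DecidableEq β]
    (s : Finset α) (U : Finset β) (f : α → Finset β) (k : ℕ)
    (hU : ∀ a ∈ s, f a ⊆ U) (hk : ∀ a ∈ s, (f a).card = k)
    (hf : ∀ a ∈ s, ∀ b ∈ s, a ≠ b → (f a ∩ f b).card ≤ 1) :
    4 * ((s.card : ℤ) * k) ≤ s.card * (s.card - 1) + 6 * U.card := by
  let r : β → ℤ := fun e => ∑ a ∈ s, if e ∈ f a then 1 else 0
  have sum_r : ∑ e ∈ U, r e = s.card * k := by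
    rw [Finset.sum_comm, Finset.sum_congr rfl (g := fun _ => (k : ℤ))]
    · simp
    · intro a ha
      rw [Finset.sum_boole, Finset.filter_mem_eq_inter, Finset.inter_eq_right.2 (hU a ha), hk a ha]
  have sum_sq : ∑ e ∈ U, r e * r e = ∑ a ∈ s, ∑ b ∈ s, ((f a ∩ f b).card : ℤ) := by
    simp only [r, Finset.sum_mul_sum]
    rw [Finset.sum_comm]
    refine Finset.sum_congr rfl fun a ha => ?_
    rw [Finset.sum_comm]
    refine Finset.sum_congr rfl fun b _ => ?_
    simp only [← ite_and, mul_ite, mul_one, mul_zero]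
    rw [Finset.sum_boole]
    congr 2
    ext e
    have := @hU a ha e
    simp only [Finset.mem_filter, Finset.mem_inter]
    tauto
  have sum_inter : ∑ a ∈ s, ∑ b ∈ s, ((f a ∩ f b).card : ℤ) ≤
      s.card * (k + (s.card - 1)) := by
    rw [← nsmul_eq_mul]
    refine Finset.sum_le_card_nsmul _ _ _ fun a ha => ?_
    rw [← Finset.add_sum_erase s _ ha, Finset.inter_self, hk a ha]
    have := Finset.sum_le_card_nsmul (s.erase a) (fun b => ((f a ∩ f b).card : ℤ)) 1
      fun b hb => by
        exact_mod_cast hf a ha b (Finset.mem_of_mem_erase hb) (Finset.ne_of_mem_erase hb).symm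
    have card_erase := Finset.card_erase_add_one ha
    simp only [nsmul_eq_mul, mul_one] at this
    linarith [show ((s.erase a).card : ℤ) + 1 = s.card by exact_mod_cast card_erase]
  have pointwise : ∑ e ∈ U, (5 * r e - 6) ≤ ∑ e ∈ U, r e * r e := by
    refine Finset.sum_le_sum fun e _ => ?_
    rcases le_or_gt (r e) 2 with h | h <;> nlinarith
  rw [Finset.sum_sub_distrib, ← Finset.mul_sum, sum_r, sum_sq] at pointwise
  simp only [Finset.sum_const, nsmul_eq_mul] at pointwise
  linarith

/-- A tree-code on `n ≥ 35` vertices whose trees share two edges and pairwise share at most three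
edges has at most `n + 4` trees. -/
theorem IsTreeCodeCommon.card_le {n : ℕ} (hn : 35 ≤ n) {C : Finset (SimpleGraph (Fin n))}
    (hC : IsTreeCodeCommon n (n - 4) 2 C) : C.card ≤ n + 4 := by
  classical
  obtain ⟨⟨tree, dist⟩, E₀, hE₀, common⟩ := hC
  by_contra! h
  obtain ⟨s, hs, hcard⟩ := Finset.exists_subset_card_eq (show n + 5 ≤ C.card from h)
  obtain ⟨E, hE, hE2⟩ := Finset.exists_subset_card_eq hE₀
  have subset_edges : ∀ G ∈ s, E ⊆ G.edgeFinset := fun G hG e he => by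
    rw [SimpleGraph.mem_edgeFinset]
    exact common G (hs hG) (hE he)
  have card_edges : ∀ G ∈ s, (G.edgeFinset \ E).card = n - 3 := fun G hG => by
    have := (tree G (hs hG)).card_edgeFinset
    rw [Finset.card_sdiff_of_subset (subset_edges G hG), hE2]
    simp only [Fintype.card_fin] at this
    omega
  have card_inter : ∀ G ∈ s, ∀ H ∈ s, G ≠ H →
      ((G.edgeFinset \ E) ∩ (H.edgeFinset \ E)).card ≤ 1 := fun G hG H hH hGH => by
    have hd := dist G (hs hG) H (hs hH) hGH
    rw [treeDist, ← SimpleGraph.coe_edgeFinset, ← SimpleGraph.coe_edgeFinset,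
      ← Finset.coe_inter, Set.ncard_coe_finset] at hd
    rw [← Finset.inf_eq_inter, ← inf_sdiff, Finset.inf_eq_inter, Finset.card_sdiff_of_subset
      (Finset.subset_inter (subset_edges G hG) (subset_edges H hH)), hE2]
    omega
  obtain ⟨G₀, hG₀⟩ : s.Nonempty := Finset.card_pos.1 (by omega)
  have card_top : ((⊤ : SimpleGraph (Fin n)).edgeFinset \ E).card + 2 = n.choose 2 := by
    have le_top := (subset_edges G₀ hG₀).trans (SimpleGraph.edgeFinset_mono (le_top (a := G₀)))
    have := Finset.card_le_card le_top
    have hc := SimpleGraph.card_edgeFinset_top_eq_card_choose_two (V := Fin n)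
    rw [Finset.card_sdiff_of_subset le_top, hE2]
    rw [Fintype.card_fin] at hc
    omega
  have key := four_mul_card_mul_le_of_card_inter_le_one s
    ((⊤ : SimpleGraph (Fin n)).edgeFinset \ E) (fun G => G.edgeFinset \ E) (n - 3)
    (fun G _ => Finset.sdiff_subset_sdiff (SimpleGraph.edgeFinset_mono le_top) le_rfl)
    card_edges card_inter
  have choose_two : (n.choose 2) * 2 = n * (n - 1) := by
    rw [Nat.choose_two_right, Nat.div_mul_cancel (Nat.even_mul_pred_self n).two_dvd]
  rw [← card_top] at choose_two
  rw [hcard] at key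
  zify [show 1 ≤ n by omega] at choose_two
  push_cast [Nat.cast_sub (show 3 ≤ n by omega)] at key
  have : (35 : ℤ) ≤ n := by exact_mod_cast hn
  nlinarith

theorem stmt9 (n : ℕ) (hn : 35 ≤ n) : Acommon n (n - 4) 2 ≤ n + 4 := by
  refine csSup_le' ?_
  rintro m ⟨C, hC, rfl⟩
  exact hC.card_le hn
end
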